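/- arXiv:2402.12494 — 2 statements merged into one kernel-verified Lean document; each statement's English description precedes it below -/
import Mathlib

section
/- Let Λ be hereditary and M a Λ-module. Then M^⊥ is closed under kernels and cokernels of morphisms between its objects: if f : A → B is a Λ-homomorphism with A, B ∈ M^⊥, then ker f ∈ M^⊥ and coker f ∈ M^⊥. -/
open CategoryTheory Abelian

noncomputable instance hasExtModuleCat (R : Type) [Ring R] : HasExt.{1} (ModuleCat.{0} R) := by
  have : HasDerivedCategory.{1} (ModuleCat.{0} R) := HasDerivedCategory.standard _
  exact hasExt_of_hasDerivedCategory _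

section

universe w v u

variable {C : Type u} [Category.{v} C] [Abelian C]

lemma shortExact_kernel_ι_factorThruImage {A B : C} (f : A ⟶ B) :
    (ShortComplex.mk (Limits.kernel.ι f) (Abelian.factorThruImage f)
      (by simp [← cancel_mono (Abelian.image.ι f)])).ShortExact where
  exact := ShortComplex.exact_of_f_is_kernel _ (Limits.isKernelOfComp _ _
    (Limits.kernelIsKernel f) _ (Abelian.image.fac f))

lemma shortExact_image_ι_cokernel_π {A B : C} (f : A ⟶ B) :
    (ShortComplex.mk (Abelian.image.ι f) (Limits.cokernel.π f)
      (Limits.kernel.condition _)).ShortExact where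
  exact := ShortComplex.exact_kernel _

variable [HasExt.{w} C]

lemma subsingleton_ext_zero_iff {X Y : C} :
    Subsingleton (Ext X Y 0) ↔ ∀ g : X ⟶ Y, g = 0 :=
  Ext.homEquiv₀.subsingleton_congr.trans
    ⟨fun _ _ => Subsingleton.elim _ _, fun h => ⟨fun a b => (h a).trans (h b).symm⟩⟩

lemma CategoryTheory.ShortComplex.ShortExact.subsingleton_ext_X₁ {S : ShortComplex C}
    (hS : S.ShortExact) (X : C) (n : ℕ) (h₃ : Subsingleton (Ext X S.X₃ n))
    (h₂ : Subsingleton (Ext X S.X₂ (n + 1))) : Subsingleton (Ext X S.X₁ (n + 1)) := by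
  refine subsingleton_of_forall_eq 0 fun x => ?_
  obtain ⟨y, rfl⟩ := Ext.covariant_sequence_exact₁ X hS x (Subsingleton.elim _ _) rfl
  rw [Subsingleton.elim y 0, Ext.zero_comp]

lemma CategoryTheory.ShortComplex.ShortExact.subsingleton_ext_X₃ {S : ShortComplex C}
    (hS : S.ShortExact) (X : C) (n : ℕ) (h₂ : Subsingleton (Ext X S.X₂ n))
    (h₁ : Subsingleton (Ext X S.X₁ (n + 1))) : Subsingleton (Ext X S.X₃ n) := by
  refine subsingleton_of_forall_eq 0 fun x => ?_
  obtain ⟨y, rfl⟩ := Ext.covariant_sequence_exact₃ X hS x rfl (Subsingleton.elim _ _)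
  rw [Subsingleton.elim y 0, Ext.zero_comp]

end

/-- over a hereditary ring, M^⊥ is closed under kernels and cokernels
of morphisms between its objects. -/
theorem stmt9 (R : Type) [Ring R]
    (hered : ∀ A' B' : ModuleCat.{0} R, Subsingleton (Ext A' B' 2))
    (M A B : ModuleCat.{0} R) (f : A ⟶ B)
    (hA : (∀ g : M ⟶ A, g = 0) ∧ Subsingleton (Ext M A 1))
    (hB : (∀ g : M ⟶ B, g = 0) ∧ Subsingleton (Ext M B 1)) :
    ((∀ g : M ⟶ Limits.kernel f, g = 0) ∧ Subsingleton (Ext M (Limits.kernel f) 1)) ∧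
    ((∀ g : M ⟶ Limits.cokernel f, g = 0) ∧ Subsingleton (Ext M (Limits.cokernel f) 1)) := by
  have hK := shortExact_kernel_ι_factorThruImage f
  have hC := shortExact_image_ι_cokernel_π f
  have image_hom : ∀ g : M ⟶ Abelian.image f, g = 0 := fun g =>
    Limits.zero_of_comp_mono (Abelian.image.ι f) (hB.1 _)
  have image_ext : Subsingleton (Ext M (Abelian.image f) 1) :=
    hK.subsingleton_ext_X₃ M 1 hA.2 (hered _ _)
  exact ⟨⟨fun g => Limits.zero_of_comp_mono (Limits.kernel.ι f) (hA.1 _),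
      hK.subsingleton_ext_X₁ M 0 (subsingleton_ext_zero_iff.2 image_hom) hA.2⟩,
    ⟨subsingleton_ext_zero_iff.1
        (hC.subsingleton_ext_X₃ M 0 (subsingleton_ext_zero_iff.2 hB.1) image_ext),
      hC.subsingleton_ext_X₃ M 1 hB.2 (hered _ _)⟩⟩
end

section
/- Let Λ be a hereditary ring, T and X modules with Ext^1(X, X) = 0 and an exact sequence 0 → X → T^s → Y → 0 where X → T^s is a left T-approximation (every map X → T factors through it). Then Ext^1(X, Z) = 0 for every Z in T^⊥; in particular if X lies in T^⊥ then X is a projective object of the exact category T^⊥ (every short exact sequence in T^⊥ ending at X splits). -/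
open CategoryTheory Abelian

universe w v u

section Abelian

variable {C : Type u} [Category.{v} C] [Abelian C] [HasExt.{w} C]

/-- If `Extⁿ(S.X₂, Z) = 0` and `Extⁿ⁺¹(S.X₃, Z) = 0` for a short exact `S`, then
`Extⁿ(S.X₁, Z) = 0`. -/
theorem subsingleton_ext_X₁_of_shortExact {S : ShortComplex C} (hS : S.ShortExact) (Z : C)
    {n m : ℕ} (hnm : 1 + n = m) [Subsingleton (Ext.{w} S.X₂ Z n)]
    [Subsingleton (Ext.{w} S.X₃ Z m)] : Subsingleton (Ext.{w} S.X₁ Z n) := by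
  refine subsingleton_of_forall_eq 0 fun e => ?_
  obtain ⟨e', rfl⟩ := Ext.contravariant_sequence_exact₁ hS Z e hnm (Subsingleton.elim _ _)
  rw [Subsingleton.elim e' 0, Ext.comp_zero]

/-- A short exact sequence splits when `Ext¹` from its right end to its left end vanishes. -/
theorem nonempty_splitting_of_subsingleton_ext {S : ShortComplex C} (hS : S.ShortExact)
    [Subsingleton (Ext.{w} S.X₃ S.X₁ 1)] : Nonempty S.Splitting := by
  obtain ⟨x, hx⟩ := Ext.covariant_sequence_exact₃ S.X₃ hS (Ext.mk₀ (𝟙 S.X₃)) (zero_add 1)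
    (Subsingleton.elim _ _)
  obtain ⟨σ, rfl⟩ := (Ext.mk₀_bijective S.X₃ S.X₂).2 x
  rw [Ext.mk₀_comp_mk₀] at hx
  exact ⟨.ofExactOfSection S hS.exact σ ((Ext.mk₀_bijective S.X₃ S.X₃).1 hx) hS.mono_f⟩

end Abelian

/-- `Ext` out of a finite power of a module vanishes when `Ext` out of the module does. -/
theorem subsingleton_ext_pi {R : Type u} [Ring R] [HasExt.{w} (ModuleCat.{v} R)]
    {ι : Type} [Fintype ι] (T Z : ModuleCat.{v} R) (n : ℕ) [Subsingleton (Ext.{w} T Z n)] :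
    Subsingleton (Ext.{w} (ModuleCat.of R (ι → T)) Z n) := by
  classical
  refine subsingleton_of_forall_eq 0 fun e => ?_
  have total : 𝟙 (ModuleCat.of R (ι → T)) = ∑ i,
      ModuleCat.ofHom (LinearMap.proj (R := R) (φ := fun _ : ι => T) i) ≫
        ModuleCat.ofHom (LinearMap.single R (fun _ : ι => T) i) := by
    refine ModuleCat.hom_ext (LinearMap.ext fun x => ?_)
    simp [ModuleCat.hom_sum, LinearMap.sum_apply, Finset.univ_sum_single]
  rw [← Ext.mk₀_id_comp e, total, Ext.mk₀_sum, Ext.sum_comp]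
  refine Finset.sum_eq_zero fun i _ => ?_
  rw [← Ext.mk₀_comp_mk₀_assoc, Subsingleton.elim (Ext.comp _ e _) 0, Ext.comp_zero]

/-- Λ hereditary, Ext¹(X,X) = 0, and 0 → X → Tˢ → Y → 0 exact with
X → Tˢ a left T-approximation. Then Ext¹(X,Z) = 0 for every Z ∈ T^⊥; in particular,
if X ∈ T^⊥ then every short exact sequence in T^⊥ ending at X splits. -/
theorem stmt10 (R : Type) [Ring R]
    (hered : ∀ A' B' : ModuleCat.{0} R, Subsingleton (Ext A' B' 2))
    (T X Y : ModuleCat.{0} R) (s : ℕ)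
    (hXX : Subsingleton (Ext X X 1))
    (f : X ⟶ ModuleCat.of R (Fin s → T)) (p : ModuleCat.of R (Fin s → T) ⟶ Y)
    (w : f ≫ p = 0) (hS : (ShortComplex.mk f p w).ShortExact)
    (happrox : ∀ g : X ⟶ T, ∃ h : ModuleCat.of R (Fin s → T) ⟶ T, f ≫ h = g) :
    (∀ Z : ModuleCat.{0} R, (∀ g : T ⟶ Z, g = 0) → Subsingleton (Ext T Z 1) →
      Subsingleton (Ext X Z 1)) ∧
    (((∀ g : T ⟶ X, g = 0) ∧ Subsingleton (Ext T X 1)) →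
      ∀ (A B : ModuleCat.{0} R) (i : A ⟶ B) (q : B ⟶ X) (w' : i ≫ q = 0)
        (hS' : (ShortComplex.mk i q w').ShortExact),
        ((∀ g : T ⟶ A, g = 0) ∧ Subsingleton (Ext T A 1)) →
        ((∀ g : T ⟶ B, g = 0) ∧ Subsingleton (Ext T B 1)) →
        Nonempty (ShortComplex.mk i q w').Splitting) := by
  have ext_eq_zero : ∀ Z : ModuleCat.{0} R, Subsingleton (Ext T Z 1) →
      Subsingleton (Ext X Z 1) := fun Z _ => by
    have : Subsingleton (Ext (ModuleCat.of R (Fin s → T)) Z 1) := subsingleton_ext_pi T Z 1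
    have := hered Y Z
    exact subsingleton_ext_X₁_of_shortExact hS Z (m := 2) rfl
  refine ⟨fun Z _ => ext_eq_zero Z, fun _ A B i q w' hS' hA _ => ?_⟩
  have := ext_eq_zero A hA.2
  exact nonempty_splitting_of_subsingleton_ext hS'
end
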